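/- arXiv:1803.02948 — 3 statements merged into one kernel-verified Lean document; each statement's English description precedes it below -/
import Mathlib

section
/- Let X, Y1 and Y2 be complex Hilbert spaces, and let A1 : X → Y1 and A2 : X → Y2 be bounded linear operators. Then there exists a constant C > 0 such that ‖A1 x‖ ≤ C ‖A2 x‖ for all x ∈ X if and only if the range of the adjoint A1* : Y1 → X is contained in the range of the adjoint A2* : Y2 → X. -/
/-- **Lemma 3.4.** Let `X`, `Y1`, `Y2` be complex Hilbert spaces and
`A1 : X → Y1`, `A2 : X → Y2` bounded linear operators. Then there exists `C > 0`
with `‖A1 x‖ ≤ C * ‖A2 x‖` for all `x` if and only if the range of the adjoint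
`A1*` is contained in the range of the adjoint `A2*`. -/
theorem norm_bound_iff_adjoint_range_subset
    {X Y1 Y2 : Type*}
    [NormedAddCommGroup X] [InnerProductSpace ℂ X] [CompleteSpace X]
    [NormedAddCommGroup Y1] [InnerProductSpace ℂ Y1] [CompleteSpace Y1]
    [NormedAddCommGroup Y2] [InnerProductSpace ℂ Y2] [CompleteSpace Y2]
    (A1 : X →L[ℂ] Y1) (A2 : X →L[ℂ] Y2) :
    (∃ C > (0 : ℝ), ∀ x : X, ‖A1 x‖ ≤ C * ‖A2 x‖) ↔
      Set.range (ContinuousLinearMap.adjoint A1) ⊆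
        Set.range (ContinuousLinearMap.adjoint A2) := by
  constructor
  · rintro ⟨C, hC, h⟩ _ ⟨y, rfl⟩
    have key : ∀ a b, A2 a = A2 b → A1 a = A1 b := by
      intro a b hab
      have h1 := h (a - b)
      rw [map_sub, map_sub, hab, sub_self, norm_zero, mul_zero] at h1
      exact sub_eq_zero.mp (norm_le_zero_iff.mp h1)
    let R : Submodule ℂ Y2 := LinearMap.range (A2 : X →ₗ[ℂ] Y2)
    have hR : ∀ v : R, ∃ x : X, A2 x = v := fun v => v.2
    choose g hg using hR
    let S : R →ₗ[ℂ] Y1 :=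
      { toFun := fun v => A1 (g v)
        map_add' := by
          intro u v
          rw [← map_add]
          apply key
          rw [map_add, hg, hg, hg]
          rfl
        map_smul' := by
          intro c v
          rw [RingHom.id_apply, ← map_smul]
          apply key
          rw [map_smul, hg, hg]
          rfl }
    let T : R →L[ℂ] Y1 := S.mkContinuous C (by
      intro v
      have h2 := h (g v)
      rw [hg] at h2
      exact h2)
    obtain ⟨φ, hφ, -⟩ := exists_extension_norm_eq R ((innerSL ℂ y).comp T)
    refine ⟨(InnerProductSpace.toDual ℂ Y2).symm φ, ?_⟩
    apply ext_inner_right ℂ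
    intro x
    rw [ContinuousLinearMap.adjoint_inner_left, ContinuousLinearMap.adjoint_inner_left,
      InnerProductSpace.toDual_symm_apply]
    have hx := hφ ⟨A2 x, ⟨x, rfl⟩⟩
    have hk : A1 (g ⟨A2 x, ⟨x, rfl⟩⟩) = A1 x := key _ _ (hg _)
    refine hx.trans ?_
    change inner ℂ y (A1 (g ⟨A2 x, ⟨x, rfl⟩⟩)) = _
    rw [hk]
  · intro h
    have key : ∀ y : Y1, ∃ z : Y2, ∀ x, inner ℂ (A1 x) y = inner ℂ (A2 x) z := by
      intro y
      obtain ⟨z, hz⟩ := h ⟨y, rfl⟩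
      refine ⟨z, fun x => ?_⟩
      rw [← ContinuousLinearMap.adjoint_inner_right, ← ContinuousLinearMap.adjoint_inner_right, hz]
    obtain ⟨C, hC⟩ := banach_steinhaus
      (g := fun x : X => ((‖A2 x‖⁻¹ : ℝ) : ℂ) • innerSL ℂ (A1 x)) (by
        intro y
        obtain ⟨z, hz⟩ := key y
        refine ⟨‖z‖, fun x => ?_⟩
        rw [ContinuousLinearMap.smul_apply, innerSL_apply_apply, hz, norm_smul, Complex.norm_real,
          norm_inv, norm_norm]
        by_cases h0 : ‖A2 x‖ = 0
        · simp [h0]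
        · rw [inv_mul_le_iff₀ (lt_of_le_of_ne (norm_nonneg _) (Ne.symm h0))]
          exact norm_inner_le_norm _ _)
    refine ⟨max C 1, by positivity, fun x => ?_⟩
    by_cases h0 : A2 x = 0
    · obtain ⟨z, hz⟩ := key (A1 x)
      have h1 := hz x
      rw [h0, inner_zero_left, inner_self_eq_zero] at h1
      simp [h0, h1]
    · have h1 := hC x
      rw [norm_smul, Complex.norm_real, norm_inv, norm_norm, innerSL_apply_norm,
        inv_mul_le_iff₀ (norm_pos_iff.mpr h0), mul_comm] at h1
      exact h1.trans (mul_le_mul_of_nonneg_right (le_max_left _ _) (norm_nonneg _))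
end

section
/- Let X, Y1 and Y2 be complex Hilbert spaces, and let A1 : X → Y1 and A2 : X → Y2 be bounded linear operators such that A1 ≠ 0, A2 is injective, and the ranges of the adjoints intersect trivially, i.e. Range(A1*) ∩ Range(A2*) = {0}. Then there exists a sequence (x_ℓ)_{ℓ ∈ ℕ} in X such that ‖A1 x_ℓ‖ → ∞ and ‖A2 x_ℓ‖ → 0 as ℓ → ∞. -/
open Filter

/-- Norm comparison implies that every `A1* y` lies in the range of `A2*` (`A2` injective). -/
theorem adjoint_mem_range_of_norm_le
    {X Y1 Y2 : Type*}
    [NormedAddCommGroup X] [InnerProductSpace ℂ X] [CompleteSpace X]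
    [NormedAddCommGroup Y1] [InnerProductSpace ℂ Y1] [CompleteSpace Y1]
    [NormedAddCommGroup Y2] [InnerProductSpace ℂ Y2] [CompleteSpace Y2]
    (A1 : X →L[ℂ] Y1) (A2 : X →L[ℂ] Y2) (hinj : Function.Injective A2)
    (C : ℝ) (hC : ∀ x, ‖A1 x‖ ≤ C * ‖A2 x‖) (y : Y1) :
    ∃ z, ContinuousLinearMap.adjoint A2 z = ContinuousLinearMap.adjoint A1 y := by
  let e := LinearEquiv.ofInjective (A2 : X →ₗ[ℂ] Y2) hinj
  have he : ∀ w, A2 (e.symm w) = (w : Y2) := fun w =>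
    congrArg Subtype.val (e.apply_symm_apply w)
  let g : (LinearMap.range (A2 : X →ₗ[ℂ] Y2)) →ₗ[ℂ] ℂ :=
    ((innerSL ℂ y).comp A1 : X →L[ℂ] ℂ).toLinearMap.comp e.symm.toLinearMap
  have hg : ∀ w, g w = inner ℂ y (A1 (e.symm w)) := fun w => rfl
  let f := g.mkContinuous (‖y‖ * C) (by
    intro w
    rw [hg]
    calc ‖inner ℂ y (A1 (e.symm w))‖ ≤ ‖y‖ * ‖A1 (e.symm w)‖ := norm_inner_le_norm _ _
      _ ≤ ‖y‖ * (C * ‖A2 (e.symm w)‖) := by gcongr; exact hC _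
      _ = ‖y‖ * C * ‖w‖ := by rw [he, mul_assoc]; rfl)
  obtain ⟨F, hF, -⟩ := exists_extension_norm_eq _ f
  refine ⟨(InnerProductSpace.toDual ℂ Y2).symm F, ?_⟩
  refine ext_inner_right ℂ fun x => ?_
  rw [ContinuousLinearMap.adjoint_inner_left, ContinuousLinearMap.adjoint_inner_left,
    InnerProductSpace.toDual_symm_apply]
  have h := hF (e x)
  have h2 : f (e x) = inner ℂ y (A1 x) := by
    change inner ℂ y (A1 (e.symm (e x))) = _
    rw [e.symm_apply_apply]
  rw [h2] at h
  exact h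

/-- The abstract functional-analytic core of Theorem 1.1/3.1: for complex Hilbert spaces
`X`, `Y1`, `Y2` and bounded linear operators `A1 : X → Y1`, `A2 : X → Y2` with `A1 ≠ 0`,
`A2` injective and `Range(A1*) ∩ Range(A2*) = {0}`, there exists a sequence `x ℓ` with
`‖A1 (x ℓ)‖ → ∞` and `‖A2 (x ℓ)‖ → 0`. -/
theorem exists_localized_sequence_of_adjoint_ranges_trivial_intersection
    {X Y1 Y2 : Type*}
    [NormedAddCommGroup X] [InnerProductSpace ℂ X] [CompleteSpace X]
    [NormedAddCommGroup Y1] [InnerProductSpace ℂ Y1] [CompleteSpace Y1]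
    [NormedAddCommGroup Y2] [InnerProductSpace ℂ Y2] [CompleteSpace Y2]
    (A1 : X →L[ℂ] Y1) (A2 : X →L[ℂ] Y2)
    (hA1 : A1 ≠ 0) (hinj : Function.Injective A2)
    (hranges : Set.range (ContinuousLinearMap.adjoint A1) ∩
        Set.range (ContinuousLinearMap.adjoint A2) = {0}) :
    ∃ x : ℕ → X,
      Tendsto (fun ℓ => ‖A1 (x ℓ)‖) atTop atTop ∧
      Tendsto (fun ℓ => ‖A2 (x ℓ)‖) atTop (nhds 0) := by
  have key : ∀ C : ℝ, ∃ x, C * ‖A2 x‖ < ‖A1 x‖ := by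
    intro C
    by_contra! hC
    apply hA1
    have h0 : ∀ y, ContinuousLinearMap.adjoint A1 y = 0 := by
      intro y
      obtain ⟨z, hz⟩ := adjoint_mem_range_of_norm_le A1 A2 hinj C hC y
      have : ContinuousLinearMap.adjoint A1 y ∈ Set.range (ContinuousLinearMap.adjoint A1) ∩
        Set.range (ContinuousLinearMap.adjoint A2) := ⟨⟨y, rfl⟩, ⟨z, hz⟩⟩
      rw [hranges] at this
      exact this
    ext x
    refine ext_inner_left ℂ fun y => ?_
    rw [← ContinuousLinearMap.adjoint_inner_left, h0]
    simp
  have key2 : ∀ n : ℕ, ∃ x, (n : ℝ) ≤ ‖A1 x‖ ∧ ‖A2 x‖ = 1 / ((n : ℝ) + 1) := by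
    intro n
    obtain ⟨x, hx⟩ := key (((n : ℝ) + 1) ^ 2)
    have hn : (0 : ℝ) < (n : ℝ) + 1 := by positivity
    have hx0 : A2 x ≠ 0 := by
      intro h
      have : x = 0 := hinj (by rw [h, map_zero])
      subst this
      simp at hx
    have hp : 0 < ‖A2 x‖ := norm_pos_iff.mpr hx0
    have hc : 0 < 1 / (((n : ℝ) + 1) * ‖A2 x‖) := by positivity
    have hcn : ‖((1 / (((n : ℝ) + 1) * ‖A2 x‖) : ℝ) : ℂ)‖ = 1 / (((n : ℝ) + 1) * ‖A2 x‖) := by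
      rw [Complex.norm_real, Real.norm_of_nonneg hc.le]
    refine ⟨((1 / (((n : ℝ) + 1) * ‖A2 x‖) : ℝ) : ℂ) • x, ?_, ?_⟩
    · rw [map_smul, norm_smul, hcn, one_div_mul_eq_div, le_div_iff₀ (by positivity)]
      nlinarith [mul_pos hn hp]
    · rw [map_smul, norm_smul, hcn]
      field_simp
  choose x h1 h2 using key2
  refine ⟨x, tendsto_atTop_mono h1 tendsto_natCast_atTop_atTop, ?_⟩
  simp only [h2]
  exact tendsto_one_div_add_atTop_nhds_zero_nat
end

section
/- (Orthogonality of Maxwell solutions to adjoint sources, from the proof of the Runge approximation theorem.) Let Ω ⊆ ℝ³ be an open set, let k ∈ ℝ, and let ε, μ : Ω → ℝ^{3×3} be continuous symmetric matrix-valued functions. Let e, h : Ω → ℂ³ be continuously differentiable vector fields solving ∇×e = ik μh and ∇×h = −ik εe in Ω, and let E, H : Ω → ℂ³ be continuously differentiable vector fields whose supports are compact subsets of Ω. Define J := ∇×H − ik εE and K := ∇×E + ik μH on Ω. Then ∫_Ω ( e · conj(J) + h · conj(K) ) dx = 0, where conj denotes componentwise complex conjugation and a · b = Σ_{i=1}^{3}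 a_i b_i (bilinear, without conjugation). -/
open MeasureTheory

noncomputable section

/-- The partial derivative `∂ᵢ f` of a scalar field `f : ℝ³ → ℂ` in the `i`-th
coordinate direction. -/
def pderiv3 (i : Fin 3) (f : EuclideanSpace ℝ (Fin 3) → ℂ)
    (x : EuclideanSpace ℝ (Fin 3)) : ℂ :=
  fderiv ℝ f x (EuclideanSpace.single i 1)

/-- The curl `∇×G` of a vector field `G : ℝ³ → ℂ³`. -/
def curl3 (G : EuclideanSpace ℝ (Fin 3) → Fin 3 → ℂ)
    (x : EuclideanSpace ℝ (Fin 3)) : Fin 3 → ℂ :=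
  fun i => pderiv3 (i + 1) (fun y => G y (i + 2)) x
    - pderiv3 (i + 2) (fun y => G y (i + 1)) x

/-- The bilinear dot product `a · b = Σ i, aᵢ * bᵢ` (without conjugation). -/
def dot3 (a b : Fin 3 → ℂ) : ℂ := ∑ i, a i * b i

/-- Action `(Mv)ᵢ = Σ j, Mᵢⱼ vⱼ` of a real 3×3 matrix on a complex vector. -/
def mulVec3 (M : Fin 3 → Fin 3 → ℝ) (v : Fin 3 → ℂ) : Fin 3 → ℂ :=
  fun i => ∑ j, (M i j : ℂ) * v j

lemma divergence_piece (Ω : Set (EuclideanSpace ℝ (Fin 3))) (hΩ : IsOpen Ω)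
    (f g : EuclideanSpace ℝ (Fin 3) → ℂ)
    (hf : ContDiffOn ℝ 1 f Ω) (hg : ContDiffOn ℝ 1 g Ω)
    (hgc : HasCompactSupport g) (hgs : tsupport g ⊆ Ω) (a : Fin 3) :
    IntegrableOn (fun x => pderiv3 a f x * starRingEnd ℂ (g x)
      + f x * starRingEnd ℂ (pderiv3 a g x)) Ω ∧
    ∫ x in Ω, (pderiv3 a f x * starRingEnd ℂ (g x)
      + f x * starRingEnd ℂ (pderiv3 a g x)) = 0 := by
  set w : EuclideanSpace ℝ (Fin 3) → ℂ := fun x => f x * starRingEnd ℂ (g x) with hw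
  have hwsub : tsupport w ⊆ tsupport g := by
    apply closure_mono
    intro x hx
    simp only [Function.mem_support, hw] at hx ⊢
    intro h0
    exact hx (by simp [h0])
  have hwc : HasCompactSupport w :=
    hgc.of_isClosed_subset (isClosed_tsupport _) hwsub
  have hwd : ContDiff ℝ 1 w := by
    rw [contDiff_iff_contDiffAt]
    intro x
    by_cases hx : x ∈ Ω
    · have h1 := hf.contDiffAt (hΩ.mem_nhds hx)
      have h2 := hg.contDiffAt (hΩ.mem_nhds hx)
      exact h1.mul (Complex.conjCLE.contDiff.contDiffAt.comp x h2)
    · have hx' : x ∉ tsupport w := fun h => hx (hgs (hwsub h))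
      have h0 : w =ᶠ[nhds x] fun _ => 0 := notMem_tsupport_iff_eventuallyEq.mp hx'
      exact contDiffAt_const.congr_of_eventuallyEq h0
  have hcont : Continuous (fun x => pderiv3 a w x) :=
    (hwd.continuous_fderiv (by norm_num)).clm_apply continuous_const
  have hcs : HasCompactSupport (fun x => pderiv3 a w x) := hwc.fderiv_apply ℝ _
  have hint : Integrable (fun x => pderiv3 a w x) := hcont.integrable_of_hasCompactSupport hcs
  have hpt : ∀ x ∈ Ω, pderiv3 a w x = pderiv3 a f x * starRingEnd ℂ (g x)
      + f x * starRingEnd ℂ (pderiv3 a g x) := by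
    intro x hx
    have h1 := ((hf.contDiffAt (hΩ.mem_nhds hx)).differentiableAt (by norm_num)).hasFDerivAt
    have h2 := ((hg.contDiffAt (hΩ.mem_nhds hx)).differentiableAt (by norm_num)).hasFDerivAt
    have h3 : HasFDerivAt (fun x => starRingEnd ℂ (g x)) _ x :=
      (Complex.conjCLE.toContinuousLinearMap.hasFDerivAt (x := g x)).comp x h2
    have h4 := (h1.mul h3).fderiv
    unfold pderiv3
    rw [show fderiv ℝ w x = _ from h4]
    simp
    ring
  constructor
  · exact (integrableOn_congr_fun hpt hΩ.measurableSet).mp hint.integrableOn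
  · rw [← setIntegral_congr_fun hΩ.measurableSet hpt,
      setIntegral_eq_integral_of_forall_compl_eq_zero]
    · have := integral_mul_fderiv_eq_neg_fderiv_mul_of_integrable (𝕜 := ℂ)
        (μ := (volume : Measure (EuclideanSpace ℝ (Fin 3))))
        (f := fun _ => (1 : ℂ)) (g := w) (v := EuclideanSpace.single a 1)
        (by simp) (by simpa [pderiv3] using hint)
        (by simpa using hwd.continuous.integrable_of_hasCompactSupport hwc)
        (fun x _ => by fun_prop) (fun x _ => hwd.differentiable (by norm_num) x)
      simpa [pderiv3] using this
    · intro x hx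
      have hx' : x ∉ tsupport w := fun h => hx (hgs (hwsub h))
      have h0 : w =ᶠ[nhds x] fun _ => 0 := notMem_tsupport_iff_eventuallyEq.mp hx'
      unfold pderiv3
      rw [h0.fderiv_eq]
      simp

lemma curl_parts (Ω : Set (EuclideanSpace ℝ (Fin 3))) (hΩ : IsOpen Ω)
    (e H : EuclideanSpace ℝ (Fin 3) → Fin 3 → ℂ)
    (he : ContDiffOn ℝ 1 e Ω) (hH : ContDiffOn ℝ 1 H Ω)
    (hc : HasCompactSupport H) (hs : tsupport H ⊆ Ω) :
    IntegrableOn (fun x => dot3 (e x) (fun i => starRingEnd ℂ (curl3 H x i))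
      - dot3 (curl3 e x) (fun i => starRingEnd ℂ (H x i))) Ω ∧
    ∫ x in Ω, (dot3 (e x) (fun i => starRingEnd ℂ (curl3 H x i))
      - dot3 (curl3 e x) (fun i => starRingEnd ℂ (H x i))) = 0 := by
  have hsub : ∀ j, tsupport (fun x => H x j) ⊆ tsupport H := by
    intro j
    apply closure_mono
    intro x hx
    simp only [Function.mem_support] at hx ⊢
    intro h0
    exact hx (by simp [h0])
  have key := fun i j a : Fin 3 => divergence_piece Ω hΩ (fun x => e x i) (fun x => H x j)
    (contDiffOn_pi.mp he i) (contDiffOn_pi.mp hH j)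
    (hc.of_isClosed_subset (isClosed_tsupport _) (hsub j)) ((hsub j).trans hs) a
  have hpt : (fun x => dot3 (e x) (fun i => starRingEnd ℂ (curl3 H x i))
      - dot3 (curl3 e x) (fun i => starRingEnd ℂ (H x i))) =
      fun x => ∑ i : Fin 3, ((pderiv3 (i+1) (fun x => e x i) x * starRingEnd ℂ (H x (i+2))
        + e x i * starRingEnd ℂ (pderiv3 (i+1) (fun x => H x (i+2)) x))
       - (pderiv3 (i+2) (fun x => e x i) x * starRingEnd ℂ (H x (i+1))
        + e x i * starRingEnd ℂ (pderiv3 (i+2) (fun x => H x (i+1)) x))) := by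
    funext x
    have a1 : (1 : Fin 3) + 1 = 2 := rfl
    have a2 : (1 : Fin 3) + 2 = 0 := rfl
    have a3 : (2 : Fin 3) + 1 = 0 := rfl
    have a4 : (2 : Fin 3) + 2 = 1 := rfl
    simp only [dot3, curl3, Fin.sum_univ_three, a1, a2, a3, a4, zero_add, map_sub]
    ring
  have hi := fun i : Fin 3 => (key i (i+2) (i+1)).1.sub (key i (i+1) (i+2)).1
  rw [hpt]
  constructor
  · exact integrable_finsetSum _ (fun i _ => hi i)
  · refine (integral_finsetSum _ (fun i _ => hi i)).trans ?_
    apply Finset.sum_eq_zero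
    intro i _
    refine (integral_sub (key i (i+2) (i+1)).1 (key i (i+1) (i+2)).1).trans ?_
    rw [
      (key i (i+2) (i+1)).2, (key i (i+1) (i+2)).2, sub_zero]

/-- The key orthogonality computation in the proof of the Runge approximation theorem
(Theorem 4.1): if `(e, h)` is a `C¹` solution of the Maxwell system `∇×e = ikμh`,
`∇×h = −ikεe` in an open set `Ω` with continuous symmetric real coefficients `ε, μ`, and
`E, H` are `C¹` vector fields with compact supports contained in `Ω`, then with the
adjoint sources `J := ∇×H − ikεE` and `K := ∇×E + ikμH` one has
`∫_Ω ( e · conj J + h · conj K ) dx = 0`. -/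
theorem runge_orthogonality
    (Ω : Set (EuclideanSpace ℝ (Fin 3))) (hΩopen : IsOpen Ω) (k : ℝ)
    (ε μ : EuclideanSpace ℝ (Fin 3) → Fin 3 → Fin 3 → ℝ)
    (hεcont : ContinuousOn ε Ω) (hμcont : ContinuousOn μ Ω)
    (hεsym : ∀ x ∈ Ω, ∀ i j, ε x i j = ε x j i)
    (hμsym : ∀ x ∈ Ω, ∀ i j, μ x i j = μ x j i)
    (e h E H : EuclideanSpace ℝ (Fin 3) → Fin 3 → ℂ)
    (he : ContDiffOn ℝ 1 e Ω) (hh : ContDiffOn ℝ 1 h Ω)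
    (hE : ContDiffOn ℝ 1 E Ω) (hH : ContDiffOn ℝ 1 H Ω)
    (hEcpt : HasCompactSupport E) (hEsub : tsupport E ⊆ Ω)
    (hHcpt : HasCompactSupport H) (hHsub : tsupport H ⊆ Ω)
    (hMaxwell1 : ∀ x ∈ Ω, ∀ i,
      curl3 e x i = Complex.I * (k : ℂ) * mulVec3 (μ x) (h x) i)
    (hMaxwell2 : ∀ x ∈ Ω, ∀ i,
      curl3 h x i = -(Complex.I * (k : ℂ)) * mulVec3 (ε x) (e x) i) :
    ∫ x in Ω,
      (dot3 (e x) (fun i => starRingEnd ℂ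
          (curl3 H x i - Complex.I * (k : ℂ) * mulVec3 (ε x) (E x) i))
        + dot3 (h x) (fun i => starRingEnd ℂ
          (curl3 E x i + Complex.I * (k : ℂ) * mulVec3 (μ x) (H x) i))) = 0 := by
  have h1 := curl_parts Ω hΩopen e H he hH hHcpt hHsub
  have h2 := curl_parts Ω hΩopen h E hh hE hEcpt hEsub
  have h3 := integral_add h1.1 h2.1
  rw [h1.2, h2.2, add_zero] at h3
  rw [← h3]
  apply setIntegral_congr_fun hΩopen.measurableSet
  intro x hx
  have m1 := hMaxwell1 x hx
  have m2 := hMaxwell2 x hx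
  have s1 := hεsym x hx
  have s2 := hμsym x hx
  simp only [dot3, m1, m2, map_sub, map_add, map_mul, Complex.conj_I, Complex.conj_ofReal,
    mulVec3, Fin.sum_univ_three]
  rw [s1 1 0, s1 2 0, s1 2 1, s2 1 0, s2 2 0, s2 2 1]
  ring
end
end
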